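/- The q-expansions of δ₁ and ε₁ have the form δ₁(τ) = 1/4 + 6q + 6q² + Σ_{n≥3} a_n qⁿ and ε₁(τ) = 1/16 − q + 7q² + Σ_{n≥3} b_n qⁿ (valid for all τ ∈ ℍ, with the series absolutely convergent), where all the higher coefficients a_n, b_n are integers. -/

import Mathlib

open Complex

noncomputable section

/-- `q^s = e^{2πisτ}`. -/
def qpow (s τ : ℂ) : ℂ := Complex.exp (2 * (Real.pi : ℂ) * Complex.I * s * τ)

/-- The Jacobi theta function `θ(v, τ)`, defined by its infinite product. -/
def jTheta (v τ : ℂ) : ℂ :=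
  2 * qpow (1/8) τ * Complex.sin ((Real.pi : ℂ) * v) *
    ∏' j : ℕ, ((1 - qpow ((j : ℂ) + 1) τ)
      * (1 - Complex.exp (2 * (Real.pi : ℂ) * Complex.I * v) * qpow ((j : ℂ) + 1) τ)
      * (1 - Complex.exp (-(2 * (Real.pi : ℂ) * Complex.I * v)) * qpow ((j : ℂ) + 1) τ))

/-- The Jacobi theta function `θ₁(v, τ)`, defined by its infinite product. -/
def jTheta1 (v τ : ℂ) : ℂ :=
  2 * qpow (1/8) τ * Complex.cos ((Real.pi : ℂ) * v) *
    ∏' j : ℕ, ((1 - qpow ((j : ℂ) + 1) τ)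
      * (1 + Complex.exp (2 * (Real.pi : ℂ) * Complex.I * v) * qpow ((j : ℂ) + 1) τ)
      * (1 + Complex.exp (-(2 * (Real.pi : ℂ) * Complex.I * v)) * qpow ((j : ℂ) + 1) τ))

/-- The Jacobi theta function `θ₂(v, τ)`, defined by its infinite product
(the `j`-th factor involves `q^{j+1-1/2}`). -/
def jTheta2 (v τ : ℂ) : ℂ :=
  ∏' j : ℕ, ((1 - qpow ((j : ℂ) + 1) τ)
    * (1 - Complex.exp (2 * (Real.pi : ℂ) * Complex.I * v) * qpow ((j : ℂ) + 1/2) τ)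
    * (1 - Complex.exp (-(2 * (Real.pi : ℂ) * Complex.I * v)) * qpow ((j : ℂ) + 1/2) τ))

/-- The Jacobi theta function `θ₃(v, τ)`, defined by its infinite product. -/
def jTheta3 (v τ : ℂ) : ℂ :=
  ∏' j : ℕ, ((1 - qpow ((j : ℂ) + 1) τ)
    * (1 + Complex.exp (2 * (Real.pi : ℂ) * Complex.I * v) * qpow ((j : ℂ) + 1/2) τ)
    * (1 + Complex.exp (-(2 * (Real.pi : ℂ) * Complex.I * v)) * qpow ((j : ℂ) + 1/2) τ))

/-- `θ'(0, τ)`: the partial derivative of `θ(v, τ)` in `v`, evaluated at `v = 0`. -/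
def jThetaDeriv (τ : ℂ) : ℂ := deriv (fun v => jTheta v τ) 0

/-- `δ₁(τ) = (1/8)(θ₂(0,τ)⁴ + θ₃(0,τ)⁴)`. -/
def delta1 (τ : ℂ) : ℂ := (1/8) * (jTheta2 0 τ ^ 4 + jTheta3 0 τ ^ 4)

/-- `ε₁(τ) = (1/16)θ₂(0,τ)⁴θ₃(0,τ)⁴`. -/
def epsilon1 (τ : ℂ) : ℂ := (1/16) * (jTheta2 0 τ ^ 4 * jTheta3 0 τ ^ 4)

section JacobiTripleProduct

open Filter Topology Finset

/-- The finite `q`-Pochhammer product `∏_{j=1}^n (1 - y^j)`. -/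
def qPoch (y : ℂ) (n : ℕ) : ℂ := ∏ j ∈ range n, (1 - y ^ (j + 1))

/-- The reciprocal of `∏_{j=1}^m (1 - y^j)`, extended by zero to negative `m`. -/
def invQPoch (y : ℂ) : ℤ → ℂ
  | .ofNat n => (qPoch y n)⁻¹
  | .negSucc _ => 0

lemma one_sub_pow_succ_ne_zero {y : ℂ} (hy : ‖y‖ < 1) (j : ℕ) : 1 - y ^ (j + 1) ≠ 0 := by
  intro h
  have h1 : ‖y ^ (j + 1)‖ = 1 := by rw [← sub_eq_zero.mp h, norm_one]
  rw [norm_pow] at h1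
  exact (pow_lt_one₀ (norm_nonneg y) hy j.succ_ne_zero).ne h1

lemma qPoch_ne_zero {y : ℂ} (hy : ‖y‖ < 1) (n : ℕ) : qPoch y n ≠ 0 :=
  prod_ne_zero_iff.mpr fun j _ => one_sub_pow_succ_ne_zero hy j

lemma qPoch_succ (y : ℂ) (n : ℕ) : qPoch y (n + 1) = qPoch y n * (1 - y ^ (n + 1)) :=
  prod_range_succ _ _

lemma invQPoch_sub_one {y : ℂ} (hy : ‖y‖ < 1) (m : ℤ) :
    invQPoch y (m - 1) = (1 - y ^ m) * invQPoch y m := by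
  match m with
  | .ofNat 0 =>
    change (0 : ℂ) = _
    simp
  | .ofNat (n + 1) =>
    have h : (Int.ofNat (n + 1) - 1) = Int.ofNat n := by simp
    have h0 := one_sub_pow_succ_ne_zero hy n
    have h1 := qPoch_ne_zero hy n
    rw [h]
    simp only [invQPoch, qPoch_succ, Int.ofNat_eq_natCast, zpow_natCast]
    field_simp
  | .negSucc n =>
    have h : Int.negSucc n - 1 = Int.negSucc (n + 1) := by grind
    simp [h, invQPoch]

/-- The `k`-th term `[2n choose n+k]_{x²} x^{k²}` of the finite form of the Jacobi triple
product. -/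
def jacobiTerm (x : ℂ) (n : ℕ) (k : ℤ) : ℂ :=
  qPoch (x ^ 2) (2 * n) * invQPoch (x ^ 2) (n - k) * invQPoch (x ^ 2) (n + k) * x ^ (k ^ 2)

lemma norm_sq_lt_one {x : ℂ} (hx : ‖x‖ < 1) : ‖x ^ 2‖ < 1 := by
  rw [norm_pow]
  exact pow_lt_one₀ (norm_nonneg x) hx two_ne_zero

lemma jacobiTerm_succ {x : ℂ} (hx0 : x ≠ 0) (hx : ‖x‖ < 1) (n : ℕ) (k : ℤ) :
    jacobiTerm x (n + 1) k = (1 + x ^ (4 * n + 2)) * jacobiTerm x n k +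
      x ^ (2 * n + 1) * (jacobiTerm x n (k - 1) + jacobiTerm x n (k + 1)) := by
  have hy := norm_sq_lt_one hx
  have hy0 : x ^ 2 ≠ 0 := pow_ne_zero 2 hx0
  set A : ℤ := n + 1 - k with hA
  set B : ℤ := n + 1 + k with hB
  have e1 : (n : ℤ) - k = A - 1 := by omega
  have e2 : (n : ℤ) + k = B - 1 := by omega
  have e3 : (n : ℤ) - (k - 1) = A := by omega
  have e4 : (n : ℤ) + (k - 1) = B - 1 - 1 := by omega
  have e5 : (n : ℤ) - (k + 1) = A - 1 - 1 := by omega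
  have e6 : (n : ℤ) + (k + 1) = B := by omega
  have p1 : x ^ (2 * n + 1) * x ^ ((k - 1) ^ 2) = x ^ (k ^ 2) * (x ^ 2) ^ A := by
    rw [← zpow_natCast x 2, ← zpow_mul, ← zpow_natCast, ← zpow_add₀ hx0, ← zpow_add₀ hx0]
    congr 1
    push_cast
    rw [hA]
    ring
  have p2 : x ^ (2 * n + 1) * x ^ ((k + 1) ^ 2) = x ^ (k ^ 2) * (x ^ 2) ^ B := by
    rw [← zpow_natCast x 2, ← zpow_mul, ← zpow_natCast, ← zpow_add₀ hx0, ← zpow_add₀ hx0]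
    congr 1
    push_cast
    rw [hB]
    ring
  have p3 : (x ^ 2) ^ A * (x ^ 2) ^ B = (x ^ 2) ^ (2 * n + 2) := by
    rw [← zpow_add₀ hy0, ← zpow_natCast (x ^ 2) (2 * n + 2)]
    congr 1
    push_cast
    omega
  have p4 : x ^ (4 * n + 2) = (x ^ 2) ^ (2 * n + 1) := by
    rw [← pow_mul]
    congr 1
    ring
  have q2 : qPoch (x ^ 2) (2 * (n + 1)) = qPoch (x ^ 2) (2 * n) *
      (1 - (x ^ 2) ^ (2 * n + 1)) * (1 - (x ^ 2) ^ (2 * n + 2)) := by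
    rw [show 2 * (n + 1) = 2 * n + 1 + 1 by ring, qPoch_succ, qPoch_succ]
  have z1 : (x ^ 2) ^ (A - 1) = (x ^ 2) ^ A / x ^ 2 := zpow_sub_one₀ hy0 A
  have z2 : (x ^ 2) ^ (B - 1) = (x ^ 2) ^ B / x ^ 2 := zpow_sub_one₀ hy0 B
  have p5 : (x ^ 2) ^ (2 * n + 1) = (x ^ 2) ^ A * (x ^ 2) ^ B / x ^ 2 := by
    rw [p3]
    field_simp
    ring
  simp only [jacobiTerm]
  push_cast
  rw [← hA, ← hB, e1, e2, e3, e4, e5, e6, q2]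
  rw [invQPoch_sub_one hy (A - 1), invQPoch_sub_one hy (B - 1), invQPoch_sub_one hy A,
    invQPoch_sub_one hy B, z1, z2, p4, ← p3, p5]
  set a := (x ^ 2) ^ A
  set b := (x ^ 2) ^ B
  set Q := qPoch (x ^ 2) (2 * n)
  set R := invQPoch (x ^ 2) A
  set S := invQPoch (x ^ 2) B
  rw [mul_add (x ^ (2 * n + 1))]
  calc _ = Q * R * S * x ^ (k ^ 2) * ((1 + a * b / x ^ 2) * (1 - a) * (1 - b) +
          a * (1 - b) * (1 - b / x ^ 2) + b * (1 - a) * (1 - a / x ^ 2)) := by ring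
    _ = Q * R * S * ((1 + a * b / x ^ 2) * (1 - a) * (1 - b) * x ^ (k ^ 2) +
          (1 - b) * (1 - b / x ^ 2) * (x ^ (k ^ 2) * a) +
          (1 - a) * (1 - a / x ^ 2) * (x ^ (k ^ 2) * b)) := by ring
    _ = _ := by
      rw [← p1, ← p2]
      ring

lemma hasSum_jacobiTerm {x : ℂ} (hx0 : x ≠ 0) (hx : ‖x‖ < 1) (n : ℕ) :
    HasSum (jacobiTerm x n) (∏ j ∈ range n, (1 + x ^ (2 * j + 1)) ^ 2) := by
  induction n with
  | zero =>
    have h : jacobiTerm x 0 0 = 1 := by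
      have h0 : invQPoch (x ^ 2) 0 = 1 := by
        change (qPoch (x ^ 2) 0)⁻¹ = 1
        simp [qPoch]
      simp [jacobiTerm, qPoch, h0]
    rw [range_zero, prod_empty, ← h]
    refine hasSum_single 0 fun k hk => ?_
    rcases lt_or_gt_of_ne hk with hk | hk
    · obtain ⟨m, rfl⟩ := Int.eq_negSucc_of_lt_zero hk
      simp [jacobiTerm, invQPoch]
    · obtain ⟨m, hm⟩ := Int.eq_negSucc_of_lt_zero (show -k < 0 by omega)
      simp [jacobiTerm, invQPoch, hm]
  | succ n ih =>
    rw [prod_range_succ]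
    have h1 := (Equiv.subRight (1 : ℤ)).hasSum_iff.mpr ih
    have h2 := (Equiv.addRight (1 : ℤ)).hasSum_iff.mpr ih
    convert! (ih.mul_left (1 + x ^ (4 * n + 2))).add ((h1.add h2).mul_left (x ^ (2 * n + 1)))
      using 1
    · funext k
      exact jacobiTerm_succ hx0 hx n k
    · ring

lemma summable_norm_pow_succ {y : ℂ} (hy : ‖y‖ < 1) : Summable fun j : ℕ => ‖-y ^ (j + 1)‖ := by
  simpa using (summable_nat_add_iff 1).mpr (summable_geometric_of_lt_one (norm_nonneg y) hy)

lemma exists_tendsto_qPoch {y : ℂ} (hy : ‖y‖ < 1) :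
    ∃ P : ℂ, P ≠ 0 ∧ Tendsto (qPoch y) atTop (𝓝 P) := by
  refine ⟨∏' j : ℕ, (1 + -y ^ (j + 1)), ?_, ?_⟩
  · exact tprod_one_add_ne_zero_of_summable
      (fun j => by simpa [← sub_eq_add_neg] using one_sub_pow_succ_ne_zero hy j)
      (summable_norm_pow_succ hy)
  · simpa only [← sub_eq_add_neg, qPoch] using!
      (multipliable_one_add_of_summable (summable_norm_pow_succ hy)).hasProd.tendsto_prod_nat

lemma summable_norm_zpow_sq {x : ℂ} (hx : ‖x‖ < 1) : Summable fun k : ℤ => ‖x ^ (k ^ 2)‖ := by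
  have h : Summable fun n : ℕ => ‖x‖ ^ (n ^ 2) :=
    (summable_geometric_of_lt_one (norm_nonneg x) hx).comp_injective
      (Nat.pow_left_injective two_ne_zero)
  refine Summable.of_nat_of_neg ?_ ?_
  · exact h.congr fun n => by rw [norm_zpow]; exact_mod_cast rfl
  · exact h.congr fun n => by rw [norm_zpow, neg_sq]; exact_mod_cast rfl

/-- The Jacobi triple product identity at `z = 1`. -/
lemma tprod_eq_tsum_zpow_sq {x : ℂ} (hx0 : x ≠ 0) (hx : ‖x‖ < 1) :
    ∏' j : ℕ, ((1 - x ^ (2 * j + 2)) * (1 + x ^ (2 * j + 1)) ^ 2) = ∑' k : ℤ, x ^ (k ^ 2) := by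
  have hy := norm_sq_lt_one hx
  obtain ⟨P, hP0, hP⟩ := exists_tendsto_qPoch hy
  have hr : Tendsto (fun n : ℕ => invQPoch (x ^ 2) n) atTop (𝓝 P⁻¹) := hP.inv₀ hP0
  have hrZ : Tendsto (invQPoch (x ^ 2)) atTop (𝓝 P⁻¹) := by
    rwa [← Nat.map_cast_int_atTop, tendsto_map'_iff]
  obtain ⟨C, hC⟩ : ∃ C, ∀ m, ‖invQPoch (x ^ 2) m‖ ≤ C := by
    obtain ⟨C, hC⟩ := hr.norm.bddAbove_range
    refine ⟨C, fun m => ?_⟩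
    cases m with
    | ofNat n => exact hC ⟨n, rfl⟩
    | negSucc n =>
      simpa [invQPoch] using (norm_nonneg _).trans (hC ⟨0, rfl⟩)
  obtain ⟨D, hD⟩ := hP.norm.bddAbove_range
  have hC0 : 0 ≤ C := (norm_nonneg _).trans (hC 0)
  have hD0 : 0 ≤ D := (norm_nonneg _).trans (hD ⟨0, rfl⟩)
  have hlim : Tendsto (fun n => ∑' k, jacobiTerm x n k) atTop
      (𝓝 (∑' k : ℤ, P⁻¹ * x ^ (k ^ 2))) := by
    refine tendsto_tsum_of_dominated_convergence
      (bound := fun k : ℤ => D * C * C * ‖x ^ (k ^ 2)‖)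
      ((summable_norm_zpow_sq hx).mul_left _) (fun k => ?_) (Eventually.of_forall fun n k => ?_)
    · have h1 : Tendsto (fun n : ℕ => invQPoch (x ^ 2) (n - k)) atTop (𝓝 P⁻¹) :=
        hrZ.comp (tendsto_atTop_add_const_right _ (-k) tendsto_natCast_atTop_atTop)
      have h2 : Tendsto (fun n : ℕ => invQPoch (x ^ 2) (n + k)) atTop (𝓝 P⁻¹) :=
        hrZ.comp (tendsto_atTop_add_const_right _ k tendsto_natCast_atTop_atTop)
      have h3 : Tendsto (fun n : ℕ => qPoch (x ^ 2) (2 * n)) atTop (𝓝 P) :=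
        hP.comp (tendsto_id.const_mul_atTop' two_pos)
      have h4 := ((h3.mul h1).mul h2).mul_const (x ^ (k ^ 2))
      rwa [mul_inv_cancel₀ hP0, one_mul] at h4
    · simp only [jacobiTerm, norm_mul]
      gcongr
      exacts [hD ⟨_, rfl⟩, hC _, hC _]
  have hfull := hP.mul hlim
  rw [tsum_mul_left, mul_inv_cancel_left₀ hP0] at hfull
  refine (tendsto_nhds_unique hfull ?_).symm
  have hmul : Multipliable fun j : ℕ => (1 - x ^ (2 * j + 2)) * (1 + x ^ (2 * j + 1)) ^ 2 := by
    have m1 := multipliable_one_add_of_summable (summable_norm_pow_succ hy)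
    have m2 : Multipliable fun j : ℕ => 1 + x ^ (2 * j + 1) := by
      refine multipliable_one_add_of_summable ?_
      simp_rw [norm_pow]
      exact (summable_geometric_of_lt_one (norm_nonneg x) hx).comp_injective
        (i := fun j : ℕ => 2 * j + 1) fun a b h => by simpa using h
    refine (m1.mul (m2.mul m2)).congr fun j => ?_
    ring
  refine hmul.hasProd.tendsto_prod_nat.congr fun n => ?_
  rw [(hasSum_jacobiTerm hx0 hx n).tsum_eq, prod_mul_distrib, qPoch]
  congr 1
  refine prod_congr rfl fun j _ => ?_
  ring

end JacobiTripleProduct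

section PowerSeriesEvaluation

open PowerSeries

/-- The integral power series `F`, evaluated at `x`, converges with sum `s`. -/
def HasEvalAt (F : ℤ⟦X⟧) (x s : ℂ) : Prop := HasSum (fun n => ((coeff n F : ℤ) : ℂ) * x ^ n) s

lemma HasEvalAt.add {F G : ℤ⟦X⟧} {x s t : ℂ} (hF : HasEvalAt F x s) (hG : HasEvalAt G x t) :
    HasEvalAt (F + G) x (s + t) := by
  unfold HasEvalAt at *
  convert! HasSum.add hF hG using 2
  simp [add_mul]

lemma HasEvalAt.mul {F G : ℤ⟦X⟧} {x s t : ℂ} (hF : HasEvalAt F x s) (hG : HasEvalAt G x t) :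
    HasEvalAt (F * G) x (s * t) := by
  have hF' := HasSum.summable hF |>.norm
  have hG' := HasSum.summable hG |>.norm
  have hterm (n : ℕ) : ∑ kl ∈ Finset.HasAntidiagonal.antidiagonal n,
      ((coeff kl.1 F : ℤ) : ℂ) * x ^ kl.1 * (((coeff kl.2 G : ℤ) : ℂ) * x ^ kl.2) =
      ((coeff n (F * G) : ℤ) : ℂ) * x ^ n := by
    rw [coeff_mul, Int.cast_sum, Finset.sum_mul]
    refine Finset.sum_congr rfl fun kl hkl => ?_
    rw [← Finset.HasAntidiagonal.mem_antidiagonal.mp hkl]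
    push_cast
    ring
  have h1 := summable_norm_sum_mul_antidiagonal_of_summable_norm hF' hG'
  have h2 := tsum_mul_tsum_eq_tsum_sum_antidiagonal_of_summable_norm hF' hG'
  rw [HasSum.tsum_eq hF, HasSum.tsum_eq hG] at h2
  simp_rw [hterm] at h1 h2
  rw [h2]
  exact h1.of_norm.hasSum

lemma HasEvalAt.nsmul {F : ℤ⟦X⟧} {x s : ℂ} (hF : HasEvalAt F x s) (c : ℕ) :
    HasEvalAt (c • F) x (c * s) := by
  unfold HasEvalAt at *
  convert! HasSum.mul_left (c : ℂ) hF using 2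
  simp [-nsmul_eq_mul, mul_assoc]

lemma coeff_evalNegHom (F : ℤ⟦X⟧) (n : ℕ) :
    coeff n (evalNegHom F) = (-1) ^ n * coeff n F :=
  coeff_rescale F (-1) n

lemma HasEvalAt.evalNegHom {F : ℤ⟦X⟧} {x s : ℂ} (hF : HasEvalAt F (-x) s) :
    HasEvalAt (PowerSeries.evalNegHom F) x s := by
  unfold HasEvalAt at *
  convert! hF using 2 with n
  rw [coeff_evalNegHom, neg_pow x]
  push_cast
  ring

/-- The even part of a convergent power series is a power series in `x ^ 2`. -/
lemma HasEvalAt.even_part {F : ℤ⟦X⟧} {x s t : ℂ} (hs : HasEvalAt F x s)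
    (ht : HasEvalAt F (-x) t) :
    HasSum (fun n => ((coeff (2 * n) F : ℤ) : ℂ) * (x ^ 2) ^ n) ((s + t) / 2) := by
  have h := (HasSum.add hs ht).div_const 2
  rw [← (mul_right_injective₀ (two_ne_zero' ℕ)).hasSum_iff] at h
  · convert! h using 2 with n
    simp [pow_mul]
  · intro n hn
    have hodd : Odd n := Nat.not_even_iff_odd.mp fun he => hn (by
      obtain ⟨m, rfl⟩ := he
      exact ⟨m, by simp [two_mul]⟩)
    simp [hodd.neg_pow]

end PowerSeriesEvaluation

section ThetaPowerSeries

open PowerSeries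

/-- The power series `∑_{n ≥ 1} X^{n²}`. -/
def sqSeries : ℤ⟦X⟧ := .mk fun n => if n ≠ 0 ∧ IsSquare n then 1 else 0

lemma hasEvalAt_sqSeries {x : ℂ} (hx : ‖x‖ < 1) :
    HasEvalAt sqSeries x ((∑' k : ℤ, x ^ (k ^ 2) - 1) / 2) := by
  have hs : Summable fun n : ℕ => x ^ (n ^ 2) :=
    (summable_geometric_of_norm_lt_one hx).comp_injective (Nat.pow_left_injective two_ne_zero)
  have h0 := hs.hasSum
  have h1 : HasSum (fun k : ℤ => x ^ (k ^ 2)) _ :=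
    HasSum.of_nat_of_neg (h0.congr_fun fun n => by exact_mod_cast rfl)
      (h0.congr_fun fun n => by rw [neg_sq]; exact_mod_cast rfl)
  have h2 : HasSum (fun n : ℕ => x ^ ((n + 1) ^ 2)) ((∑' k : ℤ, x ^ (k ^ 2) - 1) / 2) := by
    rw [h1.tsum_eq]
    convert! (hasSum_nat_add_iff' 1).mpr h0 using 1
    simp
    ring
  unfold HasEvalAt
  rw [← Function.Injective.hasSum_iff (g := fun n : ℕ => (n + 1) ^ 2)]
  · convert! h2 using 2 with n
    simp [sqSeries, IsSquare.sq]
  · intro a b h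
    simpa using Nat.pow_left_injective two_ne_zero h
  · intro n hn
    have : ¬ (n ≠ 0 ∧ IsSquare n) := by
      rintro ⟨h0, m, rfl⟩
      refine hn ⟨m - 1, ?_⟩
      have : m ≠ 0 := by rintro rfl; simp at h0
      simp [Nat.sub_add_cancel (Nat.one_le_iff_ne_zero.mpr this), sq]
    simp [sqSeries, this]

/-- The power series `W` with `(∑_{k ∈ ℤ} X^{k²})⁴ = 1 + 8 W`. -/
def thetaFourthSeries : ℤ⟦X⟧ :=
  sqSeries + 3 • (sqSeries * sqSeries) + 4 • (sqSeries * sqSeries * sqSeries) +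
    2 • (sqSeries * sqSeries * (sqSeries * sqSeries))

lemma hasEvalAt_thetaFourthSeries {x : ℂ} (hx : ‖x‖ < 1) :
    HasEvalAt thetaFourthSeries x (((∑' k : ℤ, x ^ (k ^ 2)) ^ 4 - 1) / 8) := by
  have h := hasEvalAt_sqSeries hx
  convert! ((h.add ((h.mul h).nsmul 3)).add (((h.mul h).mul h).nsmul 4)).add
    (((h.mul h).mul (h.mul h)).nsmul 2) using 1
  push_cast
  ring

lemma coeff_sqSeries :
    coeff 0 sqSeries = 0 ∧ coeff 1 sqSeries = 1 ∧ coeff 2 sqSeries = 0 ∧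
      coeff 3 sqSeries = 0 ∧ coeff 4 sqSeries = 1 := by
  simp only [sqSeries, coeff_mk]
  decide +kernel

lemma coeff_thetaFourthSeries :
    coeff 0 thetaFourthSeries = 0 ∧ coeff 1 thetaFourthSeries = 1 ∧
      coeff 2 thetaFourthSeries = 3 ∧ coeff 3 thetaFourthSeries = 4 ∧
      coeff 4 thetaFourthSeries = 3 := by
  obtain ⟨h0, h1, h2, h3, h4⟩ := coeff_sqSeries
  simp [thetaFourthSeries, coeff_mul, Finset.Nat.antidiagonal_succ, -coeff_zero_eq_constantCoeff,
    -nsmul_eq_mul, h0, h1, h2, h3, h4]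

lemma coeff_thetaFourthSeries_mul_evalNegHom :
    coeff 0 (thetaFourthSeries * evalNegHom thetaFourthSeries) = 0 ∧
      coeff 2 (thetaFourthSeries * evalNegHom thetaFourthSeries) = -1 ∧
      coeff 4 (thetaFourthSeries * evalNegHom thetaFourthSeries) = 1 := by
  obtain ⟨h0, h1, h2, h3, h4⟩ := coeff_thetaFourthSeries
  simp [coeff_mul, Finset.Nat.antidiagonal_succ, -coeff_zero_eq_constantCoeff,
    coeff_evalNegHom, h0, h1, h2, h3, h4]

end ThetaPowerSeries

lemma qpow_half_pow (τ : ℂ) (n : ℕ) : qpow (1 / 2) τ ^ n = qpow (n / 2) τ := by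
  rw [qpow, qpow, ← Complex.exp_nat_mul]
  ring_nf

lemma norm_qpow_half_lt_one {τ : ℂ} (hτ : 0 < τ.im) : ‖qpow (1 / 2) τ‖ < 1 := by
  have h : 2 * (Real.pi : ℂ) * Complex.I * (1 / 2) * τ = (Real.pi : ℂ) * (Complex.I * τ) := by
    ring
  rw [qpow, h, Complex.norm_exp, Real.exp_lt_one_iff, Complex.re_ofReal_mul]
  simpa using mul_pos Real.pi_pos hτ

lemma jTheta3_zero {τ : ℂ} (hτ : 0 < τ.im) :
    jTheta3 0 τ = ∑' k : ℤ, qpow (1 / 2) τ ^ (k ^ 2) := by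
  rw [← tprod_eq_tsum_zpow_sq (x := qpow (1 / 2) τ) (Complex.exp_ne_zero _) (norm_qpow_half_lt_one hτ), jTheta3]
  refine tprod_congr fun j => ?_
  have e1 : qpow (1 / 2) τ ^ (2 * j + 2) = qpow ((j : ℂ) + 1) τ := by
    rw [qpow_half_pow]
    push_cast
    ring_nf
  have e2 : qpow (1 / 2) τ ^ (2 * j + 1) = qpow ((j : ℂ) + 1 / 2) τ := by
    rw [qpow_half_pow]
    push_cast
    ring_nf
  rw [e1, e2, mul_zero, neg_zero, Complex.exp_zero]
  ring

lemma jTheta2_zero {τ : ℂ} (hτ : 0 < τ.im) :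
    jTheta2 0 τ = ∑' k : ℤ, (-qpow (1 / 2) τ) ^ (k ^ 2) := by
  rw [← tprod_eq_tsum_zpow_sq (x := -qpow (1 / 2) τ) (neg_ne_zero.mpr (Complex.exp_ne_zero _))
    (by simpa using norm_qpow_half_lt_one hτ), jTheta2]
  refine tprod_congr fun j => ?_
  have e1 : (-qpow (1 / 2) τ) ^ (2 * j + 2) = qpow ((j : ℂ) + 1) τ := by
    rw [Even.neg_pow (by simp [parity_simps]), qpow_half_pow]
    push_cast
    ring_nf
  have e2 : (-qpow (1 / 2) τ) ^ (2 * j + 1) = -qpow ((j : ℂ) + 1 / 2) τ := by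
    rw [Odd.neg_pow (by simp [parity_simps]), qpow_half_pow]
    push_cast
    ring_nf
  rw [e1, e2, mul_zero, neg_zero, Complex.exp_zero]
  ring

/-- The `q`-expansions `δ₁ = 1/4 + 6q + 6q² + ⋯` and `ε₁ = 1/16 - q + 7q² + ⋯`, where all the
higher coefficients are integers and the series converge absolutely on the upper half-plane.
Here `q = e^{2πiτ} = qpow 1 τ` and `a n`, `b n` are the coefficients of `q^(n+3)`. -/
theorem delta1_epsilon1_q_expansions :
    ∃ a b : ℕ → ℤ, ∀ τ : ℂ, 0 < τ.im →
      (Summable fun n : ℕ => ‖(a n : ℂ) * qpow 1 τ ^ (n + 3)‖) ∧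
      (Summable fun n : ℕ => ‖(b n : ℂ) * qpow 1 τ ^ (n + 3)‖) ∧
      delta1 τ = 1/4 + 6 * qpow 1 τ + 6 * qpow 1 τ ^ 2 +
        ∑' n : ℕ, (a n : ℂ) * qpow 1 τ ^ (n + 3) ∧
      epsilon1 τ = 1/16 - qpow 1 τ + 7 * qpow 1 τ ^ 2 +
        ∑' n : ℕ, (b n : ℂ) * qpow 1 τ ^ (n + 3) := by
  let W := thetaFourthSeries
  let G := W * PowerSeries.evalNegHom W
  refine ⟨fun n => 2 * PowerSeries.coeff (2 * (n + 3)) W,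
    fun n => PowerSeries.coeff (2 * (n + 3)) W + 4 * PowerSeries.coeff (2 * (n + 3)) G,
    fun τ hτ => ?_⟩
  have hx := norm_qpow_half_lt_one hτ
  have hq : qpow (1 / 2) τ ^ 2 = qpow 1 τ := by
    rw [qpow_half_pow]
    norm_num
  set x := qpow (1 / 2) τ
  have hp := hasEvalAt_thetaFourthSeries hx
  have hm := hasEvalAt_thetaFourthSeries (x := -x) (by simpa using hx)
  have hGp := hp.mul hm.evalNegHom
  have hGm := hm.mul (HasEvalAt.evalNegHom (x := -x) (by simpa using hp))
  have hE := hp.even_part hm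
  have hG := hGp.even_part hGm
  rw [← jTheta3_zero hτ, ← jTheta2_zero hτ, hq] at hE hG
  have hA := (hasSum_nat_add_iff' 3).mpr (hE.mul_left 2)
  have hB := (hasSum_nat_add_iff' 3).mpr (hE.add (hG.mul_left 4))
  obtain ⟨w0, -, w2, -, w4⟩ := coeff_thetaFourthSeries
  obtain ⟨g0, g2, g4⟩ := coeff_thetaFourthSeries_mul_evalNegHom
  simp only [Finset.sum_range_succ, Finset.sum_range_zero, mul_zero, mul_one,
    show 2 * 2 = 4 from rfl, w0, w2, w4, g0, g2, g4] at hA hB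
  have hA' : HasSum (fun n : ℕ =>
      ((2 * PowerSeries.coeff (2 * (n + 3)) W : ℤ) : ℂ) * qpow 1 τ ^ (n + 3)) _ :=
    hA.congr_fun fun n => by simp only [W]; push_cast; ring
  have hB' : HasSum (fun n : ℕ => ((PowerSeries.coeff (2 * (n + 3)) W +
      4 * PowerSeries.coeff (2 * (n + 3)) G : ℤ) : ℂ) * qpow 1 τ ^ (n + 3)) _ :=
    hB.congr_fun fun n => by simp only [W, G]; push_cast; ring
  refine ⟨hA'.summable.norm, hB'.summable.norm, ?_, ?_⟩
  · rw [hA'.tsum_eq, delta1]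
    push_cast
    ring
  · rw [hB'.tsum_eq, epsilon1]
    push_cast
    ring
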